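/- Let Ω = {ω0, ω1} be a binary state space, and for μ ∈ [0,1] let belief μ denote the probability vector assigning probability 1−μ to ω0 and μ to ω1. Fix a risk level r ∈ (0,1) and two utilities u_a, u_{a'} : Ω → ℝ. Then the incentive-compatible belief set I := { μ ∈ [0,1] : CVaR_r^μ(u_a) ≥ CVaR_r^μ(u_{a'}) } is convex, i.e. it is an interval: for any μ1, μ2 ∈ I and t ∈ [0,1], t·μ1 + (1−t)·μ2 ∈ I. -/

import Mathlib

/-- Reward-side CVaR at level `r` of a binary-state utility `u : Fin 2 → ℝ` under the
belief assigning probability `1 − μ` to state `0` and `μ` to state `1`. -/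
noncomputable def cvar2 (r : ℝ) (u : Fin 2 → ℝ) (μ : ℝ) : ℝ :=
  sSup (Set.range fun b : ℝ =>
    b - (1 / r) * ((1 - μ) * max (b - u 0) 0 + μ * max (b - u 1) 0))

/-- The CVaR objective of a binary lottery paying `l` with probability `p` and `h ≥ l` with
probability `q` attains its maximum at `b = l` or `b = h`. -/
lemma isGreatest_cvar_objective {r p q l h : ℝ} (hr : 0 < r) (hr1 : r ≤ 1)
    (hpq : p + q = 1) (hlh : l ≤ h) :
    IsGreatest (Set.range fun b : ℝ => b - (1 / r) * (p * max (b - l) 0 + q * max (b - h) 0))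
      (l + (h - l) * max 0 (1 - p / r)) := by
  constructor
  · rcases le_total r p with hrp | hrp
    · refine ⟨l, ?_⟩
      have h1 : 1 - p / r ≤ 0 := by
        have := (one_le_div hr).2 hrp
        linarith
      simp [max_eq_left h1, max_eq_right (sub_nonpos.2 hlh)]
    · refine ⟨h, ?_⟩
      have h1 : 0 ≤ 1 - p / r := by
        have := (div_le_one hr).2 hrp
        linarith
      simp only [max_eq_right h1, max_eq_left (sub_nonneg.2 hlh), sub_self, max_self]
      field_simp
      ring
  · rintro _ ⟨b, rfl⟩
    have key : b * r - (p * max (b - l) 0 + q * max (b - h) 0)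
        ≤ l * r + (h - l) * max 0 (r - p) := by
      have hG0 : 0 ≤ max 0 (r - p) := le_max_left _ _
      have hG1 : r - p ≤ max 0 (r - p) := le_max_right _ _
      rcases le_total b l with hbl | hbl
      · rw [max_eq_right (by linarith), max_eq_right (by linarith)]
        nlinarith [mul_nonneg (sub_nonneg.2 hlh) hG0]
      · rw [max_eq_left (by linarith : 0 ≤ b - l)]
        rcases le_total b h with hbh | hbh
        · rw [max_eq_right (by linarith)]
          nlinarith [mul_nonneg (sub_nonneg.2 hbh) hG0,
            mul_nonneg (sub_nonneg.2 hbl) (sub_nonneg.2 hG1)]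
        · rw [max_eq_left (by linarith)]
          obtain rfl : q = 1 - p := by linarith
          nlinarith [mul_nonneg (sub_nonneg.2 hlh) (sub_nonneg.2 hG1),
            mul_nonneg (sub_nonneg.2 hbh) (sub_nonneg.2 hr1)]
    have hmax : r * max 0 (1 - p / r) = max 0 (r - p) := by
      rw [mul_max_of_nonneg _ _ hr.le, mul_zero, mul_sub, mul_one, mul_div_cancel₀ _ hr.ne']
    refine le_of_mul_le_mul_right ?_ hr
    calc _ = b * r - (p * max (b - l) 0 + q * max (b - h) 0) := by field_simp
      _ ≤ _ := key
      _ = _ := by rw [← hmax]; ring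

lemma cvar2_of_le {r μ : ℝ} {u : Fin 2 → ℝ} (hr : r ∈ Set.Ioo (0 : ℝ) 1)
    (hu : u 0 ≤ u 1) :
    cvar2 r u μ = u 0 + (u 1 - u 0) * max 0 (1 - (1 - μ) / r) :=
  (isGreatest_cvar_objective hr.1 hr.2.le (by ring) hu).csSup_eq

lemma cvar2_of_ge {r μ : ℝ} {u : Fin 2 → ℝ} (hr : r ∈ Set.Ioo (0 : ℝ) 1)
    (hu : u 1 ≤ u 0) :
    cvar2 r u μ = u 1 + (u 0 - u 1) * max 0 (1 - μ / r) := by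
  rw [← (isGreatest_cvar_objective hr.1 hr.2.le (add_sub_cancel μ 1) hu).csSup_eq, cvar2]
  simp only [add_comm]

/-- The difference of two binary CVaRs is monotone or antitone in the belief. -/
lemma cvar2_sub_monotoneOn_or_antitoneOn {r : ℝ} (hr : r ∈ Set.Ioo (0 : ℝ) 1)
    (u v : Fin 2 → ℝ) :
    MonotoneOn (fun μ => cvar2 r u μ - cvar2 r v μ) (Set.Icc 0 1) ∨
      AntitoneOn (fun μ => cvar2 r u μ - cvar2 r v μ) (Set.Icc 0 1) := by
  have up {x y : ℝ} (hxy : x ≤ y) :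
      max 0 (1 - (1 - x) / r) ≤ max 0 (1 - (1 - y) / r) := by
    have := hr.1
    gcongr
  have down {x y : ℝ} (hxy : x ≤ y) : max 0 (1 - y / r) ≤ max 0 (1 - x / r) := by
    have := hr.1
    gcongr
  rcases le_total (u 0) (u 1) with hu | hu <;> rcases le_total (v 0) (v 1) with hv | hv
  · rcases le_total (v 1 - v 0) (u 1 - u 0) with hd | hd
    · left
      intro x _ y _ hxy
      simp only [cvar2_of_le hr hu, cvar2_of_le hr hv]
      nlinarith [mul_nonneg (sub_nonneg.2 hd) (sub_nonneg.2 (up hxy))]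
    · right
      intro x _ y _ hxy
      simp only [cvar2_of_le hr hu, cvar2_of_le hr hv]
      nlinarith [mul_nonneg (sub_nonneg.2 hd) (sub_nonneg.2 (up hxy))]
  · left
    intro x _ y _ hxy
    simp only [cvar2_of_le hr hu, cvar2_of_ge hr hv]
    nlinarith [mul_nonneg (sub_nonneg.2 hu) (sub_nonneg.2 (up hxy)),
      mul_nonneg (sub_nonneg.2 hv) (sub_nonneg.2 (down hxy))]
  · right
    intro x _ y _ hxy
    simp only [cvar2_of_ge hr hu, cvar2_of_le hr hv]
    nlinarith [mul_nonneg (sub_nonneg.2 hv) (sub_nonneg.2 (up hxy)),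
      mul_nonneg (sub_nonneg.2 hu) (sub_nonneg.2 (down hxy))]
  · rcases le_total (v 0 - v 1) (u 0 - u 1) with hd | hd
    · right
      intro x _ y _ hxy
      simp only [cvar2_of_ge hr hu, cvar2_of_ge hr hv]
      nlinarith [mul_nonneg (sub_nonneg.2 hd) (sub_nonneg.2 (down hxy))]
    · left
      intro x _ y _ hxy
      simp only [cvar2_of_ge hr hu, cvar2_of_ge hr hv]
      nlinarith [mul_nonneg (sub_nonneg.2 hd) (sub_nonneg.2 (down hxy))]

/-- **Convexity of the incentive-compatible belief set in the binary CVaR model.**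
For `r ∈ (0,1)` and utilities `u_a, u_a'` on the binary state space, the set
`I = { μ ∈ [0,1] : CVaR_r^μ(u_a) ≥ CVaR_r^μ(u_a') }` is convex (an interval). -/
theorem binary_cvar_ic_set_convex
    (r : ℝ) (hr : r ∈ Set.Ioo (0 : ℝ) 1)
    (ua ua' : Fin 2 → ℝ) :
    ∀ μ1 ∈ {μ : ℝ | μ ∈ Set.Icc (0 : ℝ) 1 ∧ cvar2 r ua' μ ≤ cvar2 r ua μ},
      ∀ μ2 ∈ {μ : ℝ | μ ∈ Set.Icc (0 : ℝ) 1 ∧ cvar2 r ua' μ ≤ cvar2 r ua μ},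
        ∀ t ∈ Set.Icc (0 : ℝ) 1,
          t * μ1 + (1 - t) * μ2
            ∈ {μ : ℝ | μ ∈ Set.Icc (0 : ℝ) 1 ∧ cvar2 r ua' μ ≤ cvar2 r ua μ} := by
  have hquasi : QuasiconcaveOn ℝ (Set.Icc 0 1) fun μ => cvar2 r ua μ - cvar2 r ua' μ :=
    (cvar2_sub_monotoneOn_or_antitoneOn hr ua ua').elim
      (fun h => h.quasiconcaveOn (convex_Icc 0 1)) fun h => h.quasiconcaveOn (convex_Icc 0 1)
  intro μ1 h1 μ2 h2 t ht
  have h := hquasi 0 ⟨h1.1, sub_nonneg.2 h1.2⟩ ⟨h2.1, sub_nonneg.2 h2.2⟩ ht.1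
    (sub_nonneg.2 ht.2) (add_sub_cancel t 1)
  exact ⟨h.1, sub_nonneg.1 h.2⟩
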